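/- Let α, β ≥ 0, let a > 0, let n ≥ 1 be an integer and let q ∈ (0,1) satisfy (1-q^n)·a < 1. Set δ_n = sup_{x∈[0,a], t∈[0,a]} T_{n,t}^{α,β}(s ↦ (s − (x+t))²; q; x). Then for every bounded uniformly continuous function f : [0,∞) → ℝ, sup_{x∈[0,a], t∈[0,a]} |T_{n,t}^{α,β}(f;q;x) − f(x+t)| ≤ 2·ω(f, √δ_n). -/

import Mathlib

open Filter

/-- The `q`-integer `[n]_q = (1 - q^n)/(1 - q)`. -/
noncomputable def qInt (q : ℝ) (n : ℕ) : ℝ := (1 - q ^ n) / (1 - q)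

/-- The `q`-factorial `[n]_q! = [1]_q [2]_q ⋯ [n]_q`, with `[0]_q! = 1`. -/
noncomputable def qFact (q : ℝ) (n : ℕ) : ℝ := ∏ i ∈ Finset.range n, qInt q (i + 1)

/-- The `q`-exponential `e_q^x = ∑ x^n/[n]_q!`. -/
noncomputable def qExp (q x : ℝ) : ℝ := ∑' n : ℕ, x ^ n / qFact q n

/-- The `q`-exponential `E_q^x = ∑ q^{n(n-1)/2} x^n/[n]_q!`. -/
noncomputable def qExpE (q x : ℝ) : ℝ := ∑' n : ℕ, q ^ (n * (n - 1) / 2) * x ^ n / qFact q n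

/-- The power series `A(u) = ∑ c_k u^k`. -/
noncomputable def APow (c : ℕ → ℝ) (u : ℝ) : ℝ := ∑' k : ℕ, c k * u ^ k

/-- The `q`-Appell polynomial `P_k(q;y) = [k]_q! ∑_{j=0}^k c_j y^{k-j}/[k-j]_q!`. -/
noncomputable def qAppell (c : ℕ → ℝ) (q y : ℝ) (k : ℕ) : ℝ :=
  qFact q k * ∑ j ∈ Finset.range (k + 1), c j * y ^ (k - j) / qFact q (k - j)

/-- `D_q A(1) = (A(1) - A(q))/(1-q)`. -/
noncomputable def DqA1 (c : ℕ → ℝ) (q : ℝ) : ℝ := (APow c 1 - APow c q) / (1 - q)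

/-- `D_q A(q) = (A(q) - A(q²))/((1-q) q)`. -/
noncomputable def DqAq (c : ℕ → ℝ) (q : ℝ) : ℝ := (APow c q - APow c (q ^ 2)) / ((1 - q) * q)

/-- `D_q² A(1) = (D_q A(1) - D_q A(q))/(1-q)`. -/
noncomputable def Dq2A1 (c : ℕ → ℝ) (q : ℝ) : ℝ := (DqA1 c q - DqAq c q) / (1 - q)

/-- The Stancu-type `q`-Favard–Szász operator `T_{n,t}^{α,β}(f;q;x)`. -/
noncomputable def Tq (c : ℕ → ℝ) (q : ℝ) (n : ℕ) (t α β : ℝ) (f : ℝ → ℝ) (x : ℝ) : ℝ :=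
  qExpE q (-(qInt q n * t)) / APow c 1 *
    ∑' k : ℕ, qAppell c q (qInt q n * t) k / qFact q k *
      f (x + (qInt q k + α) / (qInt q n + β))

/-- Statistical convergence of a real sequence to `l`. -/
def StatLim (x : ℕ → ℝ) (l : ℝ) : Prop :=
  ∀ ε > 0, Tendsto
    (fun n : ℕ => (((Finset.Icc 1 n).filter fun k => ε ≤ |x k - l|).card : ℝ) / n)
    atTop (nhds 0)

/-- Modulus of continuity of `f` on `[0,∞)`. -/
noncomputable def modCont (f : ℝ → ℝ) (δ : ℝ) : ℝ :=
  sSup {r : ℝ | ∃ u v : ℝ, 0 ≤ u ∧ 0 ≤ v ∧ |u - v| ≤ δ ∧ r = |f u - f v|}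

/-- Second-order modulus of smoothness of `f` on `[0,∞)`. -/
noncomputable def mod2 (f : ℝ → ℝ) (δ : ℝ) : ℝ :=
  sSup {r : ℝ | ∃ h x : ℝ, 0 < h ∧ h ≤ δ ∧ 0 ≤ x ∧
    r = |f (x + 2 * h) - 2 * f (x + h) + f x|}

lemma qi_pos {q : ℝ} (hq0 : 0 < q) (hq1 : q < 1) (i : ℕ) : 0 < qInt q (i + 1) := by
  unfold qInt
  have : q ^ (i + 1) < 1 := pow_lt_one₀ hq0.le hq1 (by omega)
  exact div_pos (by linarith) (by linarith)

lemma qi_nonneg {q : ℝ} (hq0 : 0 < q) (hq1 : q < 1) (i : ℕ) : 0 ≤ qInt q i := by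
  unfold qInt
  have : q ^ i ≤ 1 := pow_le_one₀ hq0.le hq1.le
  exact div_nonneg (by linarith) (by linarith)

lemma qi_le {q : ℝ} (hq0 : 0 < q) (hq1 : q < 1) (i : ℕ) : qInt q i ≤ 1 / (1 - q) := by
  unfold qInt
  have : 0 ≤ q ^ i := pow_nonneg hq0.le i
  exact div_le_div_of_nonneg_right (by linarith) (by linarith)

lemma qf_pos {q : ℝ} (hq0 : 0 < q) (hq1 : q < 1) (i : ℕ) : 0 < qFact q i :=
  Finset.prod_pos fun j _ => qi_pos hq0 hq1 j

lemma qf_succ (q : ℝ) (i : ℕ) : qFact q (i + 1) = qFact q i * qInt q (i + 1) := by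
  unfold qFact; rw [Finset.prod_range_succ]

lemma e_summable {q : ℝ} (hq0 : 0 < q) (hq1 : q < 1) (y : ℝ) (hy : 0 ≤ y)
    (hy1 : (1 - q) * y < 1) : Summable fun k : ℕ => y ^ k / qFact q k := by
  have ht : Tendsto (fun k : ℕ => y / qInt q (k + 1)) atTop (nhds (y / ((1 - 0) / (1 - q)))) := by
    have h0 : Tendsto (fun k : ℕ => q ^ (k + 1)) atTop (nhds 0) :=
      (tendsto_pow_atTop_nhds_zero_of_lt_one hq0.le hq1).comp (tendsto_add_atTop_nat 1)
    unfold qInt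
    refine Tendsto.div tendsto_const_nhds ((tendsto_const_nhds.sub h0).div_const _) ?_
    have : (1 - q) ≠ 0 := by linarith
    simp [this]
  have hl : y / ((1 - 0) / (1 - q)) = (1 - q) * y := by
    have : (1 - q) ≠ 0 := by linarith
    field_simp; ring
  rw [hl] at ht
  obtain ⟨r, hr1, hr2⟩ := exists_between hy1
  refine summable_of_ratio_norm_eventually_le hr2 ?_
  filter_upwards [ht.eventually_lt_const hr1] with k hk
  have h1 := qf_pos hq0 hq1 k
  have h2 := qi_pos hq0 hq1 k
  rw [qf_succ, Real.norm_of_nonneg (by positivity), Real.norm_of_nonneg (by positivity)]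
  have : y ^ (k + 1) / (qFact q k * qInt q (k + 1)) = (y / qInt q (k + 1)) * (y ^ k / qFact q k) := by
    field_simp; ring
  rw [this]
  exact mul_le_mul_of_nonneg_right hk.le (by positivity)

lemma E_norm_summable {q : ℝ} (hq0 : 0 < q) (hq1 : q < 1) (y : ℝ) (hy : 0 ≤ y)
    (hy1 : (1 - q) * y < 1) :
    Summable fun k : ℕ => ‖q ^ (k * (k - 1) / 2) * (-y) ^ k / qFact q k‖ := by
  refine Summable.of_nonneg_of_le (fun _ => norm_nonneg _) (fun k => ?_) (e_summable hq0 hq1 y hy hy1)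
  have h1 := qf_pos hq0 hq1 k
  rw [norm_div, norm_mul, norm_pow, norm_pow, norm_neg, Real.norm_of_nonneg hy,
    Real.norm_of_nonneg hq0.le, Real.norm_of_nonneg h1.le]
  refine div_le_div_of_nonneg_right ?_ h1.le
  exact mul_le_of_le_one_left (by positivity) (pow_le_one₀ hq0.le hq1.le)

lemma tri (k : ℕ) : (k + 1) * (k + 1 - 1) / 2 = k * (k - 1) / 2 + k := by
  have := Finset.sum_range_id_mul_two (k + 1)
  have h2 := Finset.sum_range_id_mul_two k
  rw [Finset.sum_range_succ] at this
  omega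

lemma gauss0 {q : ℝ} (hq0 : 0 < q) (hq1 : q < 1) (N : ℕ) :
    ∑ k ∈ Finset.range (N + 2),
      (-1) ^ k * q ^ (k * (k - 1) / 2) / (qFact q k * qFact q (N + 1 - k)) = 0 := by
  have hN := qi_pos hq0 hq1 N
  have hq : (1 - q) ≠ 0 := by linarith
  have key : qInt q (N + 1) * ∑ k ∈ Finset.range (N + 2),
      (-1) ^ k * q ^ (k * (k - 1) / 2) / (qFact q k * qFact q (N + 1 - k)) = 0 := by
    have split : ∀ k ∈ Finset.range (N + 2), qInt q (N + 1) *
        ((-1) ^ k * q ^ (k * (k - 1) / 2) / (qFact q k * qFact q (N + 1 - k))) =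
        qInt q k * ((-1) ^ k * q ^ (k * (k - 1) / 2) / (qFact q k * qFact q (N + 1 - k))) +
        q ^ k * qInt q (N + 1 - k) *
          ((-1) ^ k * q ^ (k * (k - 1) / 2) / (qFact q k * qFact q (N + 1 - k))) := by
      intro k hk
      rw [← add_mul]
      congr 1
      have hk' : k ≤ N + 1 := by simp at hk; omega
      obtain ⟨m, hm⟩ := Nat.exists_eq_add_of_le hk'
      rw [hm, Nat.add_sub_cancel_left]
      unfold qInt
      field_simp
      ring
    rw [Finset.mul_sum, Finset.sum_congr rfl split, Finset.sum_add_distrib,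
      Finset.sum_range_succ', Finset.sum_range_succ (fun k => q ^ k * qInt q (N + 1 - k) * _)]
    have z : qInt q 0 = 0 := by simp [qInt]
    rw [Nat.sub_self, z]
    simp only [zero_mul, mul_zero, add_zero]
    rw [← Finset.sum_add_distrib]
    refine Finset.sum_eq_zero fun k hk => ?_
    have hk' : k ≤ N := by simp at hk; omega
    obtain ⟨m, rfl⟩ := Nat.exists_eq_add_of_le hk'
    have e1 : k + m + 1 - (k + 1) = m := by omega
    have e2 : k + m + 1 - k = m + 1 := by omega
    rw [e1, e2, tri, qf_succ, qf_succ]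
    have := qf_pos hq0 hq1 k
    have := qf_pos hq0 hq1 m
    have := qi_pos hq0 hq1 k
    have := qi_pos hq0 hq1 m
    field_simp
    ring
  exact (mul_eq_zero.1 key).resolve_left hN.ne'

lemma E_mul_e {q : ℝ} (hq0 : 0 < q) (hq1 : q < 1) (y : ℝ) (hy : 0 ≤ y)
    (hy1 : (1 - q) * y < 1) : qExpE q (-y) * qExp q y = 1 := by
  unfold qExpE qExp
  rw [tsum_mul_tsum_eq_tsum_sum_range_of_summable_norm (E_norm_summable hq0 hq1 y hy hy1)
    (e_summable hq0 hq1 y hy hy1).norm]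
  rw [tsum_eq_single 0]
  · simp [qFact]
  · intro N hN
    obtain ⟨N, rfl⟩ := Nat.exists_eq_succ_of_ne_zero hN
    have := gauss0 hq0 hq1 N
    rw [← mul_zero (y ^ (N + 1)), ← this, Finset.mul_sum]
    refine Finset.sum_congr rfl fun k hk => ?_
    have hk' : k ≤ N + 1 := by simp at hk; omega
    have h3 : y ^ (N + 1) = y ^ k * y ^ (N + 1 - k) := by rw [← pow_add]; congr 1; omega
    have h4 : (-y) ^ k = (-1) ^ k * y ^ k := by rw [← mul_pow]; simp
    rw [h3, h4]
    simp only [Nat.succ_eq_add_one]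
    field_simp

/-- weights -/
lemma weights {q : ℝ} (hq0 : 0 < q) (hq1 : q < 1) (c : ℕ → ℝ) (hc : ∀ k, 0 ≤ c k)
    (hs : Summable c) (hA1 : 0 < APow c 1) (y : ℝ) (hy : 0 ≤ y) (hy1 : (1 - q) * y < 1) :
    ∃ w : ℕ → ℝ, (∀ k, 0 ≤ w k) ∧ HasSum w 1 ∧ ∀ g : ℕ → ℝ,
      qExpE q (-y) / APow c 1 * ∑' k, qAppell c q y k / qFact q k * g k = ∑' k, w k * g k := by
  have hE := E_mul_e hq0 hq1 y hy hy1
  have hes := e_summable hq0 hq1 y hy hy1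
  have hepos : 0 ≤ qExp q y :=
    tsum_nonneg fun k => div_nonneg (pow_nonneg hy k) (qf_pos hq0 hq1 k).le
  have hEpos : 0 < qExpE q (-y) := by
    by_contra h
    push Not at h
    nlinarith [mul_nonneg (neg_nonneg.2 h) hepos]
  have hp : ∀ k, qAppell c q y k / qFact q k =
      ∑ j ∈ Finset.range (k + 1), c j * (y ^ (k - j) / qFact q (k - j)) := by
    intro k
    have := qf_pos hq0 hq1 k
    unfold qAppell
    rw [mul_div_cancel_left₀ _ this.ne']
    exact Finset.sum_congr rfl fun j _ => by rw [mul_div_assoc]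
  have hsum := summable_norm_sum_mul_range_of_summable_norm hs.norm hes.norm
  have htot := tsum_mul_tsum_eq_tsum_sum_range_of_summable_norm hs.norm hes.norm
  have hA : APow c 1 = ∑' k, c k := by simp [APow]
  refine ⟨fun k => qExpE q (-y) / APow c 1 * (qAppell c q y k / qFact q k), ?_, ?_, ?_⟩
  · intro k
    refine mul_nonneg (div_nonneg hEpos.le hA1.le) ?_
    rw [hp]
    exact Finset.sum_nonneg fun j _ => mul_nonneg (hc j)
      (div_nonneg (pow_nonneg hy _) (qf_pos hq0 hq1 _).le)
  · have h := (hsum.of_norm.hasSum).mul_left (qExpE q (-y) / APow c 1)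
    rw [← htot, ← hA] at h
    change HasSum _ (qExpE q (-y) / APow c 1 * (APow c 1 * qExp q y)) at h
    have e : qExpE q (-y) / APow c 1 * (APow c 1 * qExp q y) = 1 := by
      have := hA1.ne'; refine Eq.trans ?_ hE; field_simp
    rw [e] at h
    simpa only [hp] using h
  · intro g
    rw [← tsum_mul_left]
    exact tsum_congr fun k => by ring

lemma modCont_bdd (f : ℝ → ℝ) (M : ℝ) (hM : ∀ u : ℝ, 0 ≤ u → |f u| ≤ M) (d : ℝ) :
    BddAbove {r : ℝ | ∃ u v : ℝ, 0 ≤ u ∧ 0 ≤ v ∧ |u - v| ≤ d ∧ r = |f u - f v|} := by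
  refine ⟨2 * M, ?_⟩
  rintro r ⟨u, v, hu, hv, -, rfl⟩
  have := abs_sub (f u) (f v)
  linarith [hM u hu, hM v hv]

lemma le_modCont (f : ℝ → ℝ) (M : ℝ) (hM : ∀ u : ℝ, 0 ≤ u → |f u| ≤ M) (d : ℝ) (u v : ℝ)
    (hu : 0 ≤ u) (hv : 0 ≤ v) (h : |u - v| ≤ d) : |f u - f v| ≤ modCont f d :=
  le_csSup (modCont_bdd f M hM d) ⟨u, v, hu, hv, h, rfl⟩

lemma modCont_nonneg (f : ℝ → ℝ) (d : ℝ) : 0 ≤ modCont f d := by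
  refine Real.sSup_nonneg ?_
  rintro r ⟨u, v, -, -, -, rfl⟩
  exact abs_nonneg _

lemma chain (f : ℝ → ℝ) (M : ℝ) (hM : ∀ u : ℝ, 0 ≤ u → |f u| ≤ M) (d : ℝ) (m : ℕ) :
    ∀ u v : ℝ, 0 ≤ u → u ≤ v → v - u ≤ (m + 1) * d → |f u - f v| ≤ (m + 1) * modCont f d := by
  induction m with
  | zero =>
    intro u v hu huv h
    have := le_modCont f M hM d u v hu (hu.trans huv) (by
      rw [abs_sub_comm, abs_of_nonneg (by linarith)]; simpa using h)
    simpa using this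
  | succ m ih =>
    intro u v hu huv h
    push_cast at h ⊢
    have hd : 0 ≤ d := by
      by_contra hd; push Not at hd
      nlinarith [(Nat.cast_nonneg m : (0:ℝ) ≤ m)]
    by_cases h1 : v - u ≤ d
    · have := le_modCont f M hM d u v hu (hu.trans huv) (by
        rw [abs_sub_comm, abs_of_nonneg (by linarith)]; exact h1)
      nlinarith [(Nat.cast_nonneg m : (0:ℝ) ≤ m), modCont_nonneg f d]
    · push Not at h1
      have a1 := le_modCont f M hM d u (u + d) hu (by linarith) (by
        rw [abs_sub_comm, abs_of_nonneg (by linarith)]; linarith)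
      have a2 := ih (u + d) v (by linarith) (by linarith) (by linarith)
      have := abs_sub_le (f u) (f (u + d)) (f v)
      linarith

lemma modCont_quad (f : ℝ → ℝ) (M : ℝ) (hM : ∀ u : ℝ, 0 ≤ u → |f u| ≤ M) (d : ℝ) (hd : 0 < d)
    (u v : ℝ) (hu : 0 ≤ u) (hv : 0 ≤ v) :
    |f u - f v| ≤ (1 + (u - v) ^ 2 / d ^ 2) * modCont f d := by
  wlog huv : u ≤ v generalizing u v
  · have := this v u hv hu (by linarith)
    rwa [abs_sub_comm, show (v - u) ^ 2 = (u - v) ^ 2 by ring] at this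
  have hw := modCont_nonneg f d
  set l := (v - u) / d with hl
  have hl0 : 0 ≤ l := div_nonneg (by linarith) hd.le
  have hvu : v - u = l * d := by rw [hl]; field_simp
  have he : (u - v) ^ 2 / d ^ 2 = l ^ 2 := by rw [hl, div_pow]; congr 1; ring
  rw [he]
  by_cases h1 : l ≤ 1
  · have := le_modCont f M hM d u v hu hv (by
      rw [abs_sub_comm, abs_of_nonneg (by linarith)]; nlinarith)
    nlinarith [mul_nonneg (sq_nonneg l) hw]
  · push Not at h1
    have h2 := chain f M hM d ⌊l⌋₊ u v hu huv (by
      rw [hvu]; exact mul_le_mul_of_nonneg_right (Nat.lt_floor_add_one l).le hd.le)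
    have h3 := Nat.floor_le hl0
    refine h2.trans (mul_le_mul_of_nonneg_right ?_ hw)
    nlinarith

/-- uniform version on `[0,a]`:
    `sup_{x,t∈[0,a]} |T_{n,t}^{α,β}(f;q;x) − f(x+t)| ≤ 2 ω(f, √δₙ)` where
    `δₙ = sup_{x,t∈[0,a]} T_{n,t}^{α,β}((s−(x+t))²;q;x)`. -/
theorem stmt_11 (q : ℝ) (hq0 : 0 < q) (hq1 : q < 1)
    (c : ℕ → ℝ) (hc : ∀ k, 0 ≤ c k)
    (hrad : ∃ R : ℝ, 1 < R ∧ Summable fun k => c k * R ^ k) (hA1 : 0 < APow c 1)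
    (α β : ℝ) (hα : 0 ≤ α) (hβ : 0 ≤ β) (a : ℝ) (ha : 0 < a)
    (n : ℕ) (hn : 1 ≤ n) (hqa : (1 - q ^ n) * a < 1)
    (f : ℝ → ℝ) (hfu : UniformContinuousOn f (Set.Ici 0))
    (hfb : ∃ M : ℝ, ∀ u : ℝ, 0 ≤ u → |f u| ≤ M)
    (δn : ℝ) (hδn : δn = sSup {r : ℝ | ∃ x t : ℝ, x ∈ Set.Icc 0 a ∧ t ∈ Set.Icc 0 a ∧
      r = Tq c q n t α β (fun s => (s - (x + t)) ^ 2) x}) :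
    sSup {r : ℝ | ∃ x t : ℝ, x ∈ Set.Icc 0 a ∧ t ∈ Set.Icc 0 a ∧
        r = |Tq c q n t α β f x - f (x + t)|} ≤
      2 * modCont f (Real.sqrt δn) := by
  obtain ⟨M, hM⟩ := hfb
  obtain ⟨R, hR1, hRs⟩ := hrad
  have hs : Summable c := by
    refine Summable.of_nonneg_of_le hc (fun k => ?_) hRs
    exact le_mul_of_one_le_right (hc k) (one_le_pow₀ hR1.le)
  have hq : 0 < 1 - q := by linarith
  have hqn : 0 < qInt q n := by
    obtain ⟨m, rfl⟩ := Nat.exists_eq_add_of_le' hn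
    exact qi_pos hq0 hq1 m
  have W : ∀ t ∈ Set.Icc 0 a, ∃ w : ℕ → ℝ, (∀ k, 0 ≤ w k) ∧ HasSum w 1 ∧ ∀ (g : ℝ → ℝ) (x : ℝ),
      Tq c q n t α β g x = ∑' k, w k * g (x + (qInt q k + α) / (qInt q n + β)) := by
    intro t ht
    obtain ⟨w, h1, h2, h3⟩ := weights hq0 hq1 c hc hs hA1 (qInt q n * t)
      (mul_nonneg hqn.le ht.1) (by
        have e : (1 - q) * (qInt q n * t) = (1 - q ^ n) * t := by
          unfold qInt; field_simp
        rw [e]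
        have : 0 ≤ 1 - q ^ n := by linarith [pow_le_one₀ hq0.le hq1.le (n := n)]
        exact (mul_le_mul_of_nonneg_left ht.2 this).trans_lt hqa)
    exact ⟨w, h1, h2, fun g x => h3 _⟩
  set s : ℕ → ℝ := fun k => (qInt q k + α) / (qInt q n + β) with hsdef
  have hs0 : ∀ k, 0 ≤ s k := fun k =>
    div_nonneg (add_nonneg (qi_nonneg hq0 hq1 k) hα) (by linarith)
  set B : ℝ := (1 / (1 - q) + α) / (qInt q n + β) with hB
  have hsB : ∀ k, s k ≤ B := fun k =>
    div_le_div_of_nonneg_right (by linarith [qi_le hq0 hq1 k]) (by linarith)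
  have hquad : ∀ x t : ℝ, t ∈ Set.Icc 0 a → ∀ k, (x + s k - (x + t)) ^ 2 ≤ (B + a) ^ 2 := by
    intro x t ht k
    have := hs0 k
    have := hsB k
    have := ht.1
    have := ht.2
    refine sq_le_sq' ?_ ?_ <;> linarith
  -- summability for bounded nonnegative functions
  have hsm : ∀ w : ℕ → ℝ, (∀ k, 0 ≤ w k) → Summable w → ∀ (g : ℕ → ℝ) (C : ℝ),
      (∀ k, |g k| ≤ C) → Summable fun k => w k * g k := by
    intro w hw hws g C hg
    refine Summable.of_norm_bounded (hws.mul_right C) fun k => ?_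
    rw [norm_mul, Real.norm_of_nonneg (hw k)]
    exact mul_le_mul_of_nonneg_left (hg k) (hw k)
  have hbdd : BddAbove {r : ℝ | ∃ x t : ℝ, x ∈ Set.Icc 0 a ∧ t ∈ Set.Icc 0 a ∧
      r = Tq c q n t α β (fun s => (s - (x + t)) ^ 2) x} := by
    refine ⟨(B + a) ^ 2, ?_⟩
    rintro r ⟨x, t, hx, ht, rfl⟩
    obtain ⟨w, h1, h2, h3⟩ := W t ht
    rw [h3]
    have h4 := (h2.mul_right ((B + a) ^ 2))
    rw [one_mul] at h4
    rw [← h4.tsum_eq]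
    refine Summable.tsum_le_tsum (fun k => mul_le_mul_of_nonneg_left (hquad x t ht k) (h1 k)) ?_
      h4.summable
    exact hsm w h1 h2.summable (fun k => (x + s k - (x + t)) ^ 2) ((B + a) ^ 2)
      (fun k => by rw [abs_of_nonneg (sq_nonneg _)]; exact hquad x t ht k)
  refine Real.sSup_le ?_ (by linarith [modCont_nonneg f (Real.sqrt δn)])
  rintro r ⟨x, t, hx, ht, rfl⟩
  have hle : Tq c q n t α β (fun s => (s - (x + t)) ^ 2) x ≤ δn := by
    rw [hδn]; exact le_csSup hbdd ⟨x, t, hx, ht, rfl⟩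
  obtain ⟨w, h1, h2, h3⟩ := W t ht
  rw [h3] at hle
  change ∑' k, w k * (x + s k - (x + t)) ^ 2 ≤ δn at hle
  have hS2 : Summable fun k => w k * (x + s k - (x + t)) ^ 2 :=
    hsm w h1 h2.summable (fun k => (x + s k - (x + t)) ^ 2) ((B + a) ^ 2)
      (fun k => by rw [abs_of_nonneg (sq_nonneg _)]; exact hquad x t ht k)
  have hnn : ∀ k, 0 ≤ w k * (x + s k - (x + t)) ^ 2 := fun k => mul_nonneg (h1 k) (sq_nonneg _)
  have hδ0 : 0 ≤ δn := (tsum_nonneg hnn).trans hle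
  rw [h3]
  change |∑' k, w k * f (x + s k) - f (x + t)| ≤ _
  have hxs : ∀ k, 0 ≤ x + s k := fun k => add_nonneg hx.1 (hs0 k)
  have hxt : 0 ≤ x + t := add_nonneg hx.1 ht.1
  have hSf : Summable fun k => w k * f (x + s k) :=
    hsm w h1 h2.summable (fun k => f (x + s k)) M (fun k => hM _ (hxs k))
  have hc1 := h2.mul_right (f (x + t))
  rw [one_mul] at hc1
  have hdiff : ∑' k, w k * f (x + s k) - f (x + t) = ∑' k, w k * (f (x + s k) - f (x + t)) := by
    rw [← hc1.tsum_eq, ← hSf.tsum_sub hc1.summable]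
    refine tsum_congr fun k => ?_
    rw [hc1.tsum_eq]; ring
  rw [hdiff]
  rcases hδ0.eq_or_lt with h0 | hpos
  · have hz : ∀ k, w k * (f (x + s k) - f (x + t)) = 0 := by
      intro k
      have h5 := (hS2.le_tsum k (fun j _ => hnn j)).trans hle
      rw [← h0] at h5
      rcases mul_eq_zero.1 (le_antisymm h5 (hnn k)) with h6 | h6
      · rw [h6, zero_mul]
      · have : x + s k = x + t := by
          have := pow_eq_zero_iff (two_ne_zero) |>.1 h6
          linarith
        rw [this]; ring
    simp only [hz, tsum_zero, abs_zero]
    linarith [modCont_nonneg f (Real.sqrt δn)]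
  · have hd : 0 < Real.sqrt δn := Real.sqrt_pos.2 hpos
    have hw := modCont_nonneg f (Real.sqrt δn)
    have hb : ∀ k, ‖w k * (f (x + s k) - f (x + t))‖ ≤
        (w k + w k * (x + s k - (x + t)) ^ 2 / δn) * modCont f (Real.sqrt δn) := by
      intro k
      have := modCont_quad f M hM _ hd (x + s k) (x + t) (hxs k) hxt
      rw [Real.sq_sqrt hδ0] at this
      rw [norm_mul, Real.norm_of_nonneg (h1 k), Real.norm_eq_abs]
      refine (mul_le_mul_of_nonneg_left this (h1 k)).trans (le_of_eq (by ring))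
    have hH := (h2.add (hS2.hasSum.div_const δn)).mul_right (modCont f (Real.sqrt δn))
    have h7 := tsum_of_norm_bounded hH hb
    rw [Real.norm_eq_abs] at h7
    refine h7.trans (mul_le_mul_of_nonneg_right ?_ hw)
    have : (∑' k, w k * (x + s k - (x + t)) ^ 2) / δn ≤ 1 := (div_le_one hpos).2 hle
    linarith
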